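/- Let ℂ[x,y]_d denote the space of homogeneous polynomials of degree d in two variables over ℂ. For a nonzero q ∈ ℂ[x,y]_2, define the linear map T_q : ℂ[x,y]_4 → ℂ[x,y]_4 by T_q(f) = (∂q/∂x)(∂f/∂y) − (∂q/∂y)(∂f/∂x). Then for every nonzero q ∈ ℂ[x,y]_2, the kernel of T_q is exactly the line spanned by q², and hence rank T_q = 4. -/

import Mathlib

open Module LinearMap MvPolynomial

/-- The operator `f ↦ (∂q/∂x)(∂f/∂y) − (∂q/∂y)(∂f/∂x)` on polynomials in two variables. -/
noncomputable def jacOp (q : MvPolynomial (Fin 2) ℂ) :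
    MvPolynomial (Fin 2) ℂ →ₗ[ℂ] MvPolynomial (Fin 2) ℂ :=
  (LinearMap.mulLeft ℂ (pderiv (0 : Fin 2) q)) ∘ₗ (pderiv (1 : Fin 2)).toLinearMap
    - (LinearMap.mulLeft ℂ (pderiv (1 : Fin 2) q)) ∘ₗ (pderiv (0 : Fin 2)).toLinearMap

open Finset.HasAntidiagonal in
theorem MvPolynomial.IsHomogeneous.exists_eq_sum_antidiagonal {R : Type*} [CommSemiring R] {n : ℕ}
    {f : MvPolynomial (Fin 2) R} (hf : f.IsHomogeneous n) :
    ∃ g : ℕ × ℕ → R, f = ∑ p ∈ antidiagonal n, C (g p) * (X 0 ^ p.1 * X 1 ^ p.2) := by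
  refine ⟨fun p => f.coeff (Finsupp.single 0 p.1 + Finsupp.single 1 p.2), ?_⟩
  have key (d : Fin 2 →₀ ℕ) (p : ℕ × ℕ) :
      Finsupp.single 0 p.1 + Finsupp.single 1 p.2 = d ↔ p = (d 0, d 1) := by
    simp [Finsupp.ext_iff, Fin.forall_fin_two, Prod.ext_iff]
  have hX (p : ℕ × ℕ) : (X 0 ^ p.1 * X 1 ^ p.2 : MvPolynomial (Fin 2) R) =
      monomial (Finsupp.single 0 p.1 + Finsupp.single 1 p.2) 1 := by
    simp [X_pow_eq_monomial, monomial_mul]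
  ext d
  simp only [hX, C_mul_monomial, mul_one, coeff_sum, coeff_monomial, key, Finset.sum_ite_eq',
    mem_antidiagonal]
  have := (key d (d 0, d 1)).2 rfl
  split_ifs with h
  · rw [this]
  · apply hf.coeff_eq_zero
    simpa [Finsupp.degree_eq_sum] using h

open Finset.HasAntidiagonal in
theorem finrank_homogeneousSubmodule_fin_two (K : Type*) [Field K] (n : ℕ) :
    finrank K (homogeneousSubmodule (Fin 2) K n) = n + 1 := by
  have e : {d : Fin 2 →₀ ℕ | d.degree = n} ≃ antidiagonal n :=
    { toFun d := ⟨(d.1 0, d.1 1), by simpa [Finsupp.degree_eq_sum] using d.2⟩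
      invFun p := ⟨Finsupp.single 0 p.1.1 + Finsupp.single 1 p.1.2, by
        simpa using mem_antidiagonal.1 p.2⟩
      left_inv d := by ext i; fin_cases i <;> simp
      right_inv p := by simp }
  have := Fintype.ofEquiv _ e.symm
  rw [homogeneousSubmodule_eq_finsupp_supported,
    (AddMonoidAlgebra.supportedEquivFinsupp _).finrank_eq, finrank_finsupp_self,
    Fintype.card_congr e]
  simp

/-- The coordinate form of `jacOp q f = 0` for a binary quadratic form with coefficients
`a, b, c` and a binary quartic with coefficients `f₀, …, f₄`. -/
theorem exists_eq_smul_of_jacobian_coeffs_eq_zero {K : Type*} [Field K] [CharZero K]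
    {a b c f₀ f₁ f₂ f₃ f₄ : K}
    (hq : a ≠ 0 ∨ b ≠ 0 ∨ c ≠ 0) (h₀ : a * f₁ = 2 * b * f₀)
    (h₁ : 2 * a * f₂ = b * f₁ + 4 * c * f₀) (h₂ : a * f₃ = c * f₁)
    (h₃ : 4 * a * f₄ + b * f₃ = 2 * c * f₂) (h₄ : 2 * b * f₄ = c * f₃) :
    ∃ k, f₀ = k * a ^ 2 ∧ f₁ = k * (2 * a * b) ∧ f₂ = k * (b ^ 2 + 2 * a * c) ∧
      f₃ = k * (2 * b * c) ∧ f₄ = k * c ^ 2 := by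
  by_cases ha : a = 0
  · by_cases hc : c = 0
    · subst ha hc
      have hb : b ≠ 0 := by simpa using hq
      have e₀ : f₀ = 0 := by simpa [hb] using h₀
      have e₁ : f₁ = 0 := by simpa [hb] using h₁
      have e₃ : f₃ = 0 := by simpa [hb] using h₃
      have e₄ : f₄ = 0 := by simpa [hb] using h₄
      exact ⟨f₂ / b ^ 2, by simp [e₀], by simp [e₁], by field_simp; ring, by simp [e₃],
        by simp [e₄]⟩
    · obtain ⟨k, e₄⟩ : ∃ k, f₄ = k * c ^ 2 := ⟨f₄ / c ^ 2, by field_simp⟩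
      have e₃ : f₃ = k * (2 * b * c) :=
        mul_left_cancel₀ hc (by linear_combination -h₄ + 2 * b * e₄)
      have e₂ : f₂ = k * (b ^ 2 + 2 * a * c) :=
        mul_left_cancel₀ (mul_ne_zero two_ne_zero hc)
          (by linear_combination -h₃ + 4 * a * e₄ + b * e₃)
      have e₁ : f₁ = k * (2 * a * b) :=
        mul_left_cancel₀ hc (by linear_combination -h₂ + a * e₃)
      have e₀ : f₀ = k * a ^ 2 :=
        mul_left_cancel₀ (mul_ne_zero (OfNat.ofNat_ne_zero 4) hc)
          (by linear_combination -h₁ + 2 * a * e₂ - b * e₁)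
      exact ⟨k, e₀, e₁, e₂, e₃, e₄⟩
  · obtain ⟨k, e₀⟩ : ∃ k, f₀ = k * a ^ 2 := ⟨f₀ / a ^ 2, by field_simp⟩
    have e₁ : f₁ = k * (2 * a * b) :=
      mul_left_cancel₀ ha (by linear_combination h₀ + 2 * b * e₀)
    have e₂ : f₂ = k * (b ^ 2 + 2 * a * c) :=
      mul_left_cancel₀ (mul_ne_zero two_ne_zero ha)
        (by linear_combination h₁ + 4 * c * e₀ + b * e₁)
    have e₃ : f₃ = k * (2 * b * c) :=
      mul_left_cancel₀ ha (by linear_combination h₂ + c * e₁)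
    have e₄ : f₄ = k * c ^ 2 :=
      mul_left_cancel₀ (mul_ne_zero (OfNat.ofNat_ne_zero 4) ha)
        (by linear_combination h₃ + 2 * c * e₂ - b * e₃)
    exact ⟨k, e₀, e₁, e₂, e₃, e₄⟩

theorem jacOp_apply (q f : MvPolynomial (Fin 2) ℂ) :
    jacOp q f = pderiv 0 q * pderiv 1 f - pderiv 1 q * pderiv 0 f := rfl

theorem jacOp_smul_sq (q : MvPolynomial (Fin 2) ℂ) (c : ℂ) : jacOp q (c • q ^ 2) = 0 := by
  rw [map_smul, jacOp_apply]
  simp only [Derivation.leibniz_pow, smul_eq_mul]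
  convert smul_zero c
  simp only [nsmul_eq_mul]
  ring

theorem exists_eq_smul_sq_of_jacOp_eq_zero {q f : MvPolynomial (Fin 2) ℂ} (hq0 : q ≠ 0)
    (hq : q.IsHomogeneous 2) (hf : f.IsHomogeneous 4) (h : jacOp q f = 0) :
    ∃ c : ℂ, f = c • q ^ 2 := by
  obtain ⟨a, b, c, rfl⟩ : ∃ a b c : ℂ,
      q = C a * X 0 ^ 2 + C b * (X 0 * X 1) + C c * X 1 ^ 2 := by
    obtain ⟨g, rfl⟩ := hq.exists_eq_sum_antidiagonal
    refine ⟨g (2, 0), g (1, 1), g (0, 2), ?_⟩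
    simp only [Finset.Nat.sum_antidiagonal_eq_sum_range_succ_mk, Finset.sum_range_succ,
      Finset.sum_range_zero]
    simp
    ring
  obtain ⟨f₀, f₁, f₂, f₃, f₄, rfl⟩ : ∃ f₀ f₁ f₂ f₃ f₄ : ℂ,
      f = C f₀ * X 0 ^ 4 + C f₁ * (X 0 ^ 3 * X 1) + C f₂ * (X 0 ^ 2 * X 1 ^ 2)
        + C f₃ * (X 0 * X 1 ^ 3) + C f₄ * X 1 ^ 4 := by
    obtain ⟨g, rfl⟩ := hf.exists_eq_sum_antidiagonal
    refine ⟨g (4, 0), g (3, 1), g (2, 2), g (1, 3), g (0, 4), ?_⟩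
    simp only [Finset.Nat.sum_antidiagonal_eq_sum_range_succ_mk, Finset.sum_range_succ,
      Finset.sum_range_zero]
    simp
    ring
  have hv (s t : ℂ) := congrArg (eval ![s, t]) h
  simp only [jacOp_apply, map_add, map_sub, map_mul, map_pow, map_zero, Derivation.leibniz,
    Derivation.leibniz_pow, pderiv_X, pderiv_C, smul_eq_mul, nsmul_eq_mul, map_natCast, eval_C,
    eval_X, Matrix.cons_val_zero, Matrix.cons_val_one, Pi.single_apply, map_one,
    Fin.isValue, zero_ne_one, one_ne_zero, ite_true, ite_false] at hv
  push_cast at hv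
  have v₀ := hv 1 0
  have v₁ := hv 0 1
  have v₂ := hv 1 1
  have v₃ := hv 1 (-1)
  have v₄ := hv 1 2
  have hne : a ≠ 0 ∨ b ≠ 0 ∨ c ≠ 0 := by
    contrapose! hq0
    simp [hq0]
  obtain ⟨k, rfl, rfl, rfl, rfl, rfl⟩ :=
    exists_eq_smul_of_jacobian_coeffs_eq_zero (f₀ := f₀) (f₁ := f₁) (f₂ := f₂) (f₃ := f₃)
      (f₄ := f₄) hne
      (by linear_combination v₀ / 2)
      (by linear_combination (v₂ - v₃) / 4 - (v₄ + 3 * v₀ - 12 * v₁ - 3 * v₂ - v₃) / 12)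
      (by linear_combination (v₂ + v₃) / 12 - v₀ / 6 - v₁ / 6)
      (by linear_combination (v₄ + 3 * v₀ - 12 * v₁ - 3 * v₂ - v₃) / 12)
      (by linear_combination v₁ / 2)
  refine ⟨k, ?_⟩
  simp only [smul_eq_C_mul, map_mul, map_add, map_pow, map_ofNat]
  ring

/-- For every nonzero homogeneous quadratic `q` in two variables, the operator
`T_q(f) = (∂q/∂x)(∂f/∂y) − (∂q/∂y)(∂f/∂x)` restricted to the 5-dimensional space of quartics
has kernel exactly the line spanned by `q²`, hence rank `4`. -/
theorem jacOp_ker_eq_span_sq_and_rank_eq_four (q : MvPolynomial (Fin 2) ℂ) (hq0 : q ≠ 0)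
    (hq : q ∈ homogeneousSubmodule (Fin 2) ℂ 2) :
    (∀ f : homogeneousSubmodule (Fin 2) ℂ 4,
        (jacOp q).domRestrict (homogeneousSubmodule (Fin 2) ℂ 4) f = 0 ↔
          ∃ c : ℂ, (f : MvPolynomial (Fin 2) ℂ) = c • q ^ 2) ∧
      finrank ℂ (LinearMap.range ((jacOp q).domRestrict (homogeneousSubmodule (Fin 2) ℂ 4))) = 4 := by
  have hker (f : MvPolynomial (Fin 2) ℂ) (hf : f.IsHomogeneous 4) :
      jacOp q f = 0 ↔ ∃ c : ℂ, f = c • q ^ 2 :=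
    ⟨exists_eq_smul_sq_of_jacOp_eq_zero hq0 hq hf, by rintro ⟨c, rfl⟩; exact jacOp_smul_sq q c⟩
  refine ⟨fun f => hker f f.2, ?_⟩
  set T := (jacOp q).domRestrict (homogeneousSubmodule (Fin 2) ℂ 4)
  let v : homogeneousSubmodule (Fin 2) ℂ 4 := ⟨q ^ 2, IsHomogeneous.pow hq 2⟩
  have hv : v ≠ 0 := fun h => pow_ne_zero 2 hq0 (congrArg Subtype.val h)
  have hT : LinearMap.ker T = ℂ ∙ v := by
    ext f
    rw [LinearMap.mem_ker, Submodule.mem_span_singleton]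
    refine (hker f f.2).trans (exists_congr fun c => ?_)
    rw [Subtype.ext_iff, eq_comm]
    rfl
  have hdim := finrank_homogeneousSubmodule_fin_two ℂ 4
  have : FiniteDimensional ℂ (homogeneousSubmodule (Fin 2) ℂ 4) :=
    .of_finrank_pos (by simp [hdim])
  have := T.finrank_range_add_finrank_ker
  rw [hT, finrank_span_singleton hv, hdim] at this
  omega
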